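/- arXiv:1011.6198 — 2 statements merged into one kernel-verified Lean document; each statement's English description precedes it below -/
import Mathlib

section
/- Let f : (0, ∞) → ℝ satisfy f(x) = √(2/(πx))·cos(x − π/4) + O(x^{−3/2}) as x → ∞, and let (t_ν)_{ν≥1} be a sequence with t_ν > e, t_ν → ∞, satisfying the Titchmarsh gap asymptotic: there exist C > 0 and ν₀ such that for all ν ≥ ν₀, |t_{ν+1} − t_ν − 2π/log t_ν − 2π·log(2π)/log² t_ν| ≤ C/log³ t_ν. Then f(t_ν) − f(t_{ν+1}) = (2√(2π)/(√t_ν · log t_ν))·sin(t_ν − π/4) + O(1/(√t_ν · log² t_ν)); that is, there exist C′ > 0 and ν₁ such that for all ν ≥ ν₁, |f(t_ν) − f(t_{ν+1}) − (2√(2π)/(√t_ν · log t_ν))·sin(t_ν − π/4)| ≤ C′/(√t_ν · log² t_ν). (This combines formulas (3.7) and (3.8) of the paper and gives the right-hand side of (3.9).) -/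
open Real

theorem rpow_neg_three_half {x : ℝ} (hx : 0 < x) :
    x ^ (-(3:ℝ)/2) = 1 / (x * √x) := by
  rw [show (-(3:ℝ)/2) = -(1 + 1/2) by norm_num, rpow_neg hx.le, rpow_add hx, rpow_one,
    ← sqrt_eq_rpow, one_div]

theorem abs_cos_sub_cos_add_sub_le (a h : ℝ) (hh : |h| ≤ 1) :
    |cos a - cos (a + h) - h * sin a| ≤ h ^ 2 := by
  have hc := cos_bound hh
  have hs := sin_bound hh
  have h0 := abs_nonneg h
  have h2 : |h| ^ 2 = h ^ 2 := sq_abs h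
  have h4 : |h| ^ 4 ≤ |h| ^ 2 := pow_le_pow_of_le_one h0 hh (by norm_num)
  have h3 : |h ^ 3| ≤ |h| ^ 2 := by
    rw [abs_pow]
    exact pow_le_pow_of_le_one h0 hh (by norm_num)
  have e : cos a - cos (a + h) - h * sin a = cos a * (1 - cos h) + sin a * (sin h - h) := by
    rw [cos_add]
    ring
  have hc' : |1 - cos h| ≤ (1 / 2 + 5 / 96) * h ^ 2 := by
    rw [abs_le] at hc ⊢
    constructor <;> nlinarith [sq_nonneg h]
  have hs' : |sin h - h| ≤ (1 / 6 + 5 / 96) * h ^ 2 := by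
    rw [abs_le] at hs h3 ⊢
    constructor <;> nlinarith [sq_nonneg h]
  calc _ ≤ |cos a| * |1 - cos h| + |sin a| * |sin h - h| := by
        rw [e, ← abs_mul, ← abs_mul]
        exact abs_add_le _ _
    _ ≤ 1 * |1 - cos h| + 1 * |sin h - h| := by
        gcongr
        · exact abs_cos_le_one a
        · exact abs_sin_le_one a
    _ ≤ h ^ 2 := by nlinarith [sq_nonneg h]

theorem half_sqrt_le_sqrt {x y : ℝ} (hy : x / 4 ≤ y) : √x / 2 ≤ √y := by
  have : √(x / 4) = √x / 2 := by
    rw [sqrt_div' _ (by norm_num), show (4:ℝ) = 2 ^ 2 by norm_num, sqrt_sq (by norm_num)]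
  exact this ▸ sqrt_le_sqrt hy

theorem abs_one_div_sqrt_sub_one_div_sqrt_le {x y : ℝ} (hx : 0 < x) (hy : x / 4 ≤ y) :
    |1 / √x - 1 / √y| ≤ 2 * |y - x| / (x * √x) := by
  have hy0 : 0 < y := by linarith
  have sx := sqrt_pos.2 hx
  have sy := sqrt_pos.2 hy0
  have hxy := half_sqrt_le_sqrt hy
  have ex := sq_sqrt hx.le
  have ey := sq_sqrt hy0.le
  have e : 1 / √x - 1 / √y = (y - x) / (√x * √y * (√x + √y)) := by
    field_simp
    nlinarith
  rw [e, abs_div, abs_of_pos (a := √x * √y * (√x + √y)) (by positivity),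
    div_le_div_iff₀ (by positivity) (by positivity)]
  have key : x * √x ≤ 2 * (√x * √y * (√x + √y)) := by
    calc x * √x = 2 * (√x * (√x / 2) * (√x + 0)) := by nlinarith
      _ ≤ _ := by gcongr
  nlinarith [mul_le_mul_of_nonneg_left key (abs_nonneg (y - x))]

theorem one_div_mul_sqrt_le {x y : ℝ} (hx : 0 < x) (hy : x / 4 ≤ y) :
    1 / (y * √y) ≤ 8 / (x * √x) := by
  have sx := sqrt_pos.2 hx
  have hxy := half_sqrt_le_sqrt hy
  have hy0 : 0 ≤ y := by linarith
  calc 1 / (y * √y) ≤ 1 / (x / 4 * (√x / 2)) := by gcongr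
    _ = 8 / (x * √x) := by
      field_simp
      norm_num

theorem sqrt_two_div_pi_mul {x : ℝ} : √(2 / (π * x)) = √(2 / π) * (1 / √x) := by
  rw [← div_div, sqrt_div (by positivity)]
  ring

theorem sqrt_two_div_pi_mul_two_pi : √(2 / π) * (2 * π) = 2 * √(2 * π) := by
  have : 2 * π = (2 / π) * π ^ 2 := by field_simp
  rw [this, sqrt_mul (by positivity), sqrt_sq pi_pos.le, ← this]
  ring

/-- Pointwise form of the difference asymptotic, with explicit constants. -/
theorem abs_bessel_diff_sub_le {f : ℝ → ℝ} {x y L A B M : ℝ} (hL : 1 ≤ L) (hLx : L ^ 2 ≤ x)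
    (hB : B ≤ L) (hy : x / 4 ≤ y) (hM : 0 ≤ M)
    (hfx : |f x - √(2 / (π * x)) * cos (x - π / 4)| ≤ M * x ^ (-(3:ℝ)/2))
    (hfy : |f y - √(2 / (π * y)) * cos (y - π / 4)| ≤ M * y ^ (-(3:ℝ)/2))
    (hA : |y - x - 2 * π / L| ≤ A / L ^ 2) (hh : |y - x| ≤ B / L) :
    |f x - f y - (2 * √(2 * π) / (√x * L)) * sin (x - π / 4)|
      ≤ (9 * M + √(2 / π) * (B ^ 2 + A + 2)) / (√x * L ^ 2) := by
  have hL0 : 0 < L := by linarith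
  have hx : 0 < x := lt_of_lt_of_le (by positivity) hLx
  have hy0 : 0 < y := by linarith
  have sx := sqrt_pos.2 hx
  have h1 : |y - x| ≤ 1 := hh.trans ((div_le_one hL0).2 hB)
  have hx3 : 1 / (x * √x) ≤ 1 / (√x * L ^ 2) := by
    rw [mul_comm x]
    gcongr
  have bx : |f x - √(2 / (π * x)) * cos (x - π / 4)| ≤ M * (1 / (√x * L ^ 2)) := by
    rw [rpow_neg_three_half hx] at hfx
    exact hfx.trans (by gcongr)
  have b_y : |f y - √(2 / (π * y)) * cos (y - π / 4)| ≤ 8 * M * (1 / (√x * L ^ 2)) := by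
    rw [rpow_neg_three_half hy0] at hfy
    calc _ ≤ M * (1 / (y * √y)) := hfy
      _ ≤ M * (8 / (x * √x)) := by
        gcongr ?_ * ?_
        exact one_div_mul_sqrt_le hx hy
      _ = 8 * M * (1 / (x * √x)) := by ring
      _ ≤ _ := by gcongr
  have bamp : |(1 / √x - 1 / √y) * cos (y - π / 4)| ≤ 2 * (1 / (√x * L ^ 2)) := by
    rw [abs_mul]
    calc _ ≤ (2 * |y - x| / (x * √x)) * 1 := by
          gcongr
          · exact abs_one_div_sqrt_sub_one_div_sqrt_le hx hy
          · exact abs_cos_le_one _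
      _ ≤ (2 * 1 / (x * √x)) * 1 := by gcongr
      _ = 2 * (1 / (x * √x)) := by ring
      _ ≤ _ := by gcongr
  have bosc : |cos (x - π / 4) - cos (y - π / 4) - 2 * π / L * sin (x - π / 4)|
      ≤ (B ^ 2 + A) / L ^ 2 := by
    have b1 := abs_cos_sub_cos_add_sub_le (x - π / 4) (y - x) h1
    rw [show x - π / 4 + (y - x) = y - π / 4 by ring] at b1
    have b2 : |(y - x - 2 * π / L) * sin (x - π / 4)| ≤ A / L ^ 2 := by
      rw [abs_mul]
      exact (mul_le_of_le_one_right (abs_nonneg _) (abs_sin_le_one _)).trans hA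
    have b3 : (y - x) ^ 2 ≤ B ^ 2 / L ^ 2 := by
      rw [← sq_abs, ← div_pow]
      gcongr
    calc _ = |(cos (x - π / 4) - cos (y - π / 4) - (y - x) * sin (x - π / 4))
          + (y - x - 2 * π / L) * sin (x - π / 4)| := by ring_nf
      _ ≤ _ := abs_add_le _ _
      _ ≤ B ^ 2 / L ^ 2 + A / L ^ 2 := by linarith
      _ = _ := by ring
  have bosc' : |1 / √x * (cos (x - π / 4) - cos (y - π / 4) - 2 * π / L * sin (x - π / 4))|
      ≤ (B ^ 2 + A) * (1 / (√x * L ^ 2)) := by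
    rw [abs_mul, abs_of_pos (a := 1 / √x) (by positivity)]
    calc _ ≤ 1 / √x * ((B ^ 2 + A) / L ^ 2) := by gcongr
      _ = _ := by
        field_simp
  rw [sqrt_two_div_pi_mul] at bx b_y
  rw [← sqrt_two_div_pi_mul_two_pi]
  have hc : 0 ≤ √(2 / π) := sqrt_nonneg _
  have bmain : |√(2 / π) * (1 / √x * (cos (x - π / 4) - cos (y - π / 4)
      - 2 * π / L * sin (x - π / 4)) + (1 / √x - 1 / √y) * cos (y - π / 4))|
      ≤ √(2 / π) * ((B ^ 2 + A) * (1 / (√x * L ^ 2)) + 2 * (1 / (√x * L ^ 2))) := by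
    rw [abs_mul, abs_of_nonneg hc]
    exact mul_le_mul_of_nonneg_left ((abs_add_le _ _).trans (add_le_add bosc' bamp)) hc
  have e : f x - f y - √(2 / π) * (2 * π) / (√x * L) * sin (x - π / 4)
      = (f x - √(2 / π) * (1 / √x) * cos (x - π / 4))
        - (f y - √(2 / π) * (1 / √y) * cos (y - π / 4))
        + √(2 / π) * (1 / √x * (cos (x - π / 4) - cos (y - π / 4)
          - 2 * π / L * sin (x - π / 4)) + (1 / √x - 1 / √y) * cos (y - π / 4)) := by
    rw [← div_div, div_eq_mul_inv _ L, div_eq_mul_inv _ √x]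
    ring
  rw [e]
  refine (abs_add_le _ _).trans ?_
  have := abs_sub (f x - √(2 / π) * (1 / √x) * cos (x - π / 4))
    (f y - √(2 / π) * (1 / √y) * cos (y - π / 4))
  rw [div_eq_mul_one_div (9 * M + _)]
  linarith

/-- Combination of (3.7) and (3.8): if `f(x) = √(2/(πx)) cos(x − π/4) + O(x^{−3/2})` and `(t_ν)`
satisfies the Titchmarsh gap asymptotic, then
`f(t_ν) − f(t_{ν+1}) = (2√(2π)/(√t_ν log t_ν)) sin(t_ν − π/4) + O(1/(√t_ν log² t_ν))`. -/
theorem bessel_diff_gram_full_asymptotic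
    (f : ℝ → ℝ)
    (hf : ∃ K : ℝ, ∃ x₀ : ℝ, ∀ x ≥ x₀,
      |f x - Real.sqrt (2 / (Real.pi * x)) * Real.cos (x - Real.pi / 4)|
        ≤ K * x ^ (-(3:ℝ)/2))
    (t : ℕ → ℝ) (ht : ∀ ν, Real.exp 1 < t ν)
    (htend : Filter.Tendsto t Filter.atTop Filter.atTop)
    (hgap : ∃ C > (0:ℝ), ∃ ν₀ : ℕ, ∀ ν ≥ ν₀,
      |t (ν + 1) - t ν - 2 * Real.pi / Real.log (t ν)
        - 2 * Real.pi * Real.log (2 * Real.pi) / (Real.log (t ν)) ^ 2|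
        ≤ C / (Real.log (t ν)) ^ 3) :
    ∃ C' > (0:ℝ), ∃ ν₁ : ℕ, ∀ ν ≥ ν₁,
      |f (t ν) - f (t (ν + 1))
        - (2 * Real.sqrt (2 * Real.pi) / (Real.sqrt (t ν) * Real.log (t ν)))
          * Real.sin (t ν - Real.pi / 4)|
        ≤ C' / (Real.sqrt (t ν) * (Real.log (t ν)) ^ 2) := by
  obtain ⟨K, x₀, hf⟩ := hf
  obtain ⟨C, hC, ν₀, hgap⟩ := hgap
  set A : ℝ := |2 * π * log (2 * π)| + C with hA
  set B : ℝ := 2 * π + A with hB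
  have hA0 : 0 ≤ A := by positivity
  have hlog : Filter.Tendsto (fun ν => log (t ν)) Filter.atTop Filter.atTop :=
    tendsto_log_atTop.comp htend
  have hsq : ∀ᶠ ν in Filter.atTop, log (t ν) ^ 2 ≤ t ν := by
    have h := (isLittleO_pow_log_id_atTop (n := 2)).bound (c := 1) one_pos
    filter_upwards [htend.eventually h] with ν hν
    have ht0 : 0 < t ν := (exp_pos 1).trans (ht ν)
    simpa [abs_of_pos ht0] using hν
  have hnext : Filter.Tendsto (fun ν => t (ν + 1)) Filter.atTop Filter.atTop :=
    htend.comp (Filter.tendsto_add_atTop_nat 1)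
  have hev := (Filter.eventually_ge_atTop ν₀).and <| hsq.and <|
    (hlog.eventually_ge_atTop B).and <| (htend.eventually_ge_atTop x₀).and <|
    (hnext.eventually_ge_atTop x₀).and (htend.eventually_ge_atTop 4)
  obtain ⟨ν₁, hν₁⟩ := Filter.eventually_atTop.1 hev
  refine ⟨9 * |K| + √(2 / π) * (B ^ 2 + A + 2), by positivity, ν₁, fun ν hν => ?_⟩
  obtain ⟨hν₀, hLx, hBL, hx, hy, hx4⟩ := hν₁ ν hν
  have hbound : ∀ x ≥ x₀, 0 < x → |f x - √(2 / (π * x)) * cos (x - π / 4)|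
      ≤ |K| * x ^ (-(3:ℝ)/2) := fun x h h0 =>
    (hf x h).trans (mul_le_mul_of_nonneg_right (le_abs_self K) (by positivity))
  have hpos : ∀ μ, 0 < t μ := fun μ => (exp_pos 1).trans (ht μ)
  have hL : 1 ≤ log (t ν) := ((lt_log_iff_exp_lt (hpos ν)).2 (ht ν)).le
  have hg := hgap ν hν₀
  set L := log (t ν)
  have hL0 : 0 < L := by linarith
  have hgA : |t (ν + 1) - t ν - 2 * π / L| ≤ A / L ^ 2 := by
    have h1 : C / L ^ 3 ≤ C / L ^ 2 := by
      gcongr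
      norm_num
    have h2 : |2 * π * log (2 * π) / L ^ 2| = |2 * π * log (2 * π)| / L ^ 2 := by
      rw [abs_div, abs_of_pos (a := L ^ 2) (by positivity)]
    have h3 := abs_sub_abs_le_abs_sub (t (ν + 1) - t ν - 2 * π / L)
      (2 * π * log (2 * π) / L ^ 2)
    rw [hA, add_div]
    linarith
  have hgB : |t (ν + 1) - t ν| ≤ B / L := by
    have h1 : A / L ^ 2 ≤ A / L := by
      gcongr
      nlinarith
    have h2 : |2 * π / L| = 2 * π / L := abs_of_pos (by positivity)
    have h3 := abs_sub_abs_le_abs_sub (t (ν + 1) - t ν) (2 * π / L)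
    rw [hB, add_div]
    linarith
  have hle : t ν / 4 ≤ t (ν + 1) := by
    have h1 : B / L ≤ 1 := (div_le_one hL0).2 hBL
    have := (abs_le.1 hgB).1
    linarith
  exact abs_bessel_diff_sub_le hL hLx hBL hle (abs_nonneg K) (hbound _ hx (hpos ν))
    (hbound _ hy (hpos _)) hgA hgB
end

section
/- (Remark 1.) Let (t_ν)_{ν≥1} be a strictly increasing sequence with t_ν > e and t_ν → ∞ satisfying the Titchmarsh gap asymptotic: there exist C > 0 and ν₀ such that for all ν ≥ ν₀, |t_{ν+1} − t_ν − 2π/log t_ν − 2π·log(2π)/log² t_ν| ≤ C/log³ t_ν. Let (μ_n)_{n≥1} be a strictly increasing sequence with μ_n → ∞ and μ_{n+1} − μ_n → π as n → ∞. For each n, let N_n denote the number of indices ν with [t_ν, t_{ν+1}] ⊆ [μ_n, μ_{n+1}]. Then N_n ∼ (1/2)·log μ_n as n → ∞, i.e., N_n/((1/2)·log μ_n) → 1. -/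
open Real Filter

/-- If consecutive gaps of a sequence lie in `[p, q]` whenever they meet `[a, b]`, then the number
of gaps contained in `[a, b]` is controlled by `b - a`. -/
theorem card_gaps_bounds {t : ℕ → ℝ} (ht : StrictMono t) (htend : Tendsto t atTop atTop)
    {a b p q : ℝ} (ha : t 0 < a) (hab : a ≤ b) (hq : 0 ≤ q)
    (hgap : ∀ ν, t ν ≤ b → a ≤ t (ν + 1) → p ≤ t (ν + 1) - t ν ∧ t (ν + 1) - t ν ≤ q) :
    (Nat.card {ν : ℕ | Set.Icc (t ν) (t (ν + 1)) ⊆ Set.Icc a b} : ℝ) * p ≤ b - a ∧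
      b - a ≤ ((Nat.card {ν : ℕ | Set.Icc (t ν) (t (ν + 1)) ⊆ Set.Icc a b} : ℝ) + 2) * q := by
  classical
  have exA : ∃ ν, a ≤ t ν := (htend.eventually_ge_atTop a).exists
  have exB : ∃ ν, b < t ν := (htend.eventually_gt_atTop b).exists
  obtain ⟨A, hA, hA'⟩ : ∃ A, a ≤ t (A + 1) ∧ t A < a := by
    have hs := Nat.find_spec exA
    have hm := fun m => Nat.find_min exA (m := m)
    generalize Nat.find exA = k at hs hm
    cases k with
    | zero => linarith
    | succ k => exact ⟨k, hs, not_le.1 (hm k (Nat.lt_succ_self k))⟩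
  obtain ⟨B, hB, hB'⟩ : ∃ B, b < t (B + 1) ∧ t B ≤ b := by
    have hs := Nat.find_spec exB
    have hm := fun m => Nat.find_min exB (m := m)
    generalize Nat.find exB = k at hs hm
    cases k with
    | zero => linarith
    | succ k => exact ⟨k, hs, not_lt.1 (hm k (Nat.lt_succ_self k))⟩
  have hset : {ν : ℕ | Set.Icc (t ν) (t (ν + 1)) ⊆ Set.Icc a b} =
      (Finset.Ico (A + 1) B : Set ℕ) := by
    ext ν
    simp only [Set.mem_ofPred_eq, Finset.coe_Ico, Set.mem_Ico,
      Set.Icc_subset_Icc_iff (ht (Nat.lt_succ_self ν)).le]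
    constructor
    · rintro ⟨h1, h2⟩
      exact ⟨ht.lt_iff_lt.1 (hA'.trans_le h1),
        Nat.lt_of_succ_lt_succ (ht.lt_iff_lt.1 (h2.trans_lt hB))⟩
    · rintro ⟨h1, h2⟩
      exact ⟨hA.trans (ht.monotone h1), (ht.monotone h2).trans hB'⟩
  have hcard : Nat.card {ν : ℕ | Set.Icc (t ν) (t (ν + 1)) ⊆ Set.Icc a b} = B - (A + 1) := by
    rw [hset, Nat.card_coe_set_eq, Set.ncard_coe_finset, Nat.card_Ico]
  rw [hcard]
  have hAB : A ≤ B :=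
    Nat.lt_succ_iff.1 (ht.lt_iff_lt.1 ((hA'.trans_le hab).trans hB))
  have lower : ∀ k, A + 1 ≤ k → k ≤ B → ((k : ℝ) - (A + 1)) * p ≤ t k - t (A + 1) := by
    intro k hk
    induction k, hk using Nat.le_induction with
    | base => intro _; push_cast; simp
    | succ k hk ih =>
      intro hkB
      have h1 := ih (by omega)
      have h2 := (hgap k ((ht.monotone (by omega)).trans hB')
        (hA.trans (ht.monotone (by omega)))).1
      push_cast
      linarith
  have upper : ∀ k, A ≤ k → k ≤ B + 1 → t k - t A ≤ ((k : ℝ) - A) * q := by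
    intro k hk
    induction k, hk using Nat.le_induction with
    | base => intro _; simp
    | succ k hk ih =>
      intro hkB
      have h1 := ih (by omega)
      have h2 := (hgap k ((ht.monotone (by omega)).trans hB')
        (hA.trans (ht.monotone (by omega)))).2
      push_cast
      linarith
  constructor
  · rcases le_or_gt (A + 1) B with h | h
    · have := lower B h le_rfl
      push_cast [Nat.cast_sub h]
      linarith
    · rw [Nat.sub_eq_zero_of_le h.le]
      simpa using hab
  · have h1 := upper (B + 1) (by omega) le_rfl
    have h2 : ((B + 1 : ℕ) : ℝ) - A ≤ ((B - (A + 1) : ℕ) : ℝ) + 2 := by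
      have : B + 1 ≤ (B - (A + 1)) + 2 + A := by omega
      have : ((B + 1 : ℕ) : ℝ) ≤ (((B - (A + 1)) + 2 + A : ℕ) : ℝ) := by exact_mod_cast this
      push_cast at this ⊢
      linarith
    have := mul_le_mul_of_nonneg_right h2 hq
    linarith

/-- A sequence `g = c / ℓ + K / ℓ ^ 2 + O(1 / ℓ ^ 3)` with `ℓ → ∞` satisfies `g * ℓ → c`. -/
theorem tendsto_mul_of_abs_sub_le {g l : ℕ → ℝ} {c K C : ℝ} (hl : Tendsto l atTop atTop)
    (h : ∀ᶠ ν in atTop, |g ν - c / l ν - K / l ν ^ 2| ≤ C / l ν ^ 3) :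
    Tendsto (fun ν => g ν * l ν) atTop (nhds c) := by
  have hinv : Tendsto (fun ν => (l ν)⁻¹) atTop (nhds 0) := tendsto_inv_atTop_zero.comp hl
  have hK : Tendsto (fun ν => c + K * (l ν)⁻¹) atTop (nhds c) := by
    simpa using (hinv.const_mul K).const_add c
  have hC : Tendsto (fun ν => C * (l ν)⁻¹ ^ 2) atTop (nhds 0) := by
    simpa using (hinv.pow 2).const_mul C
  have hdiff : Tendsto (fun ν => g ν * l ν - (c + K * (l ν)⁻¹)) atTop (nhds 0) := by
    refine squeeze_zero_norm' ?_ hC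
    filter_upwards [h, hl.eventually_gt_atTop 0] with ν hν hpos
    have e : g ν * l ν - (c + K * (l ν)⁻¹) = (g ν - c / l ν - K / l ν ^ 2) * l ν := by
      field_simp
      ring
    rw [Real.norm_eq_abs, e, abs_mul, abs_of_pos hpos]
    refine (mul_le_mul_of_nonneg_right hν hpos.le).trans (le_of_eq ?_)
    field_simp
  simpa using hdiff.add hK

/-- If the gaps `g` of `t` satisfy `g * log t → c`, then gaps meeting `[a, b]` with `b ≤ 2 a` and
`a` large are between `c₁ / log a` and `c₂ / log a`, for any `c₁ < c < c₂`. -/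
theorem eventually_gap_bounds {t : ℕ → ℝ} (ht : StrictMono t) (htend : Tendsto t atTop atTop)
    {c c₁ c₂ : ℝ} (hc₁ : c₁ < c) (hc₂ : c < c₂)
    (hg : Tendsto (fun ν => (t (ν + 1) - t ν) * log (t ν)) atTop (nhds c)) :
    ∀ᶠ a : ℝ in atTop, ∀ ν, t ν ≤ 2 * a → a ≤ t (ν + 1) →
      c₁ / log a ≤ t (ν + 1) - t ν ∧ t (ν + 1) - t ν ≤ c₂ / log a := by
  have hl : Tendsto (fun ν => log (t ν)) atTop atTop := tendsto_log_atTop.comp htend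
  have hg0 : Tendsto (fun ν => t (ν + 1) - t ν) atTop (nhds 0) := by
    have := hg.mul (tendsto_inv_atTop_zero.comp hl)
    rw [mul_zero] at this
    refine this.congr' ?_
    filter_upwards [hl.eventually_gt_atTop 0] with ν hν
    simp only [Function.comp_apply]
    field_simp
  have hup : Tendsto (fun ν => (t (ν + 1) - t ν) * log (t ν) + (t (ν + 1) - t ν) * log 2)
      atTop (nhds c) := by
    simpa using hg.add (hg0.mul_const (log 2))
  have hlow : Tendsto (fun ν => (t (ν + 1) - t ν) * log (t ν) - (t (ν + 1) - t ν) * log 2)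
      atTop (nhds c) := by
    simpa using hg.sub (hg0.mul_const (log 2))
  obtain ⟨M, hM⟩ := eventually_atTop.1
    ((hup.eventually_le_const hc₂).and ((hlow.eventually_const_le hc₁).and
      ((hg0.eventually_le_const one_pos).and (htend.eventually_gt_atTop 0))))
  filter_upwards [eventually_gt_atTop (t M), eventually_ge_atTop 2] with a haM ha2 ν hν2 hν
  have hMν : M ≤ ν := Nat.lt_succ_iff.1 (ht.lt_iff_lt.1 (haM.trans_le hν))
  obtain ⟨h1, h2, h3, h4⟩ := hM ν hMν
  have hpos : 0 < t (ν + 1) - t ν := sub_pos.2 (ht (Nat.lt_succ_self ν))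
  have hla : 0 < log a := log_pos (by linarith)
  have hlog1 : log a ≤ log (t ν) + log 2 := by
    rw [← log_mul h4.ne' two_ne_zero]
    exact log_le_log (by linarith) (by linarith)
  have hlog2 : log (t ν) ≤ log a + log 2 := by
    rw [← log_mul (by linarith) two_ne_zero]
    exact log_le_log h4 (by linarith)
  rw [div_le_iff₀ hla, le_div_iff₀ hla]
  constructor
  · have := mul_le_mul_of_nonneg_left hlog2 hpos.le
    linarith
  · have := mul_le_mul_of_nonneg_left hlog1 hpos.le
    linarith

/-- Remark 1 of the paper: if `(t_ν)` is a Gram-like sequence satisfying the Titchmarsh gap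
asymptotic and `(μ_n)` is an increasing sequence with `μ_{n+1} − μ_n → π` (abstracting the
positive zeros of `J₁`), then the number `N_n` of indices `ν` with
`[t_ν, t_{ν+1}] ⊆ [μ_n, μ_{n+1}]` satisfies `N_n ∼ (1/2) log μ_n`. -/
theorem gram_intervals_count_asymptotic
    (t : ℕ → ℝ) (ht_mono : StrictMono t) (ht : ∀ ν, Real.exp 1 < t ν)
    (htend : Filter.Tendsto t Filter.atTop Filter.atTop)
    (hgap : ∃ C > (0:ℝ), ∃ ν₀ : ℕ, ∀ ν ≥ ν₀,
      |t (ν + 1) - t ν - 2 * Real.pi / Real.log (t ν)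
        - 2 * Real.pi * Real.log (2 * Real.pi) / (Real.log (t ν)) ^ 2|
        ≤ C / (Real.log (t ν)) ^ 3)
    (μ : ℕ → ℝ) (hμ_mono : StrictMono μ)
    (hμ_tend : Filter.Tendsto μ Filter.atTop Filter.atTop)
    (hμ_gap : Filter.Tendsto (fun n => μ (n + 1) - μ n) Filter.atTop (nhds Real.pi)) :
    Filter.Tendsto
      (fun n =>
        (Nat.card {ν : ℕ | Set.Icc (t ν) (t (ν + 1)) ⊆ Set.Icc (μ n) (μ (n + 1))} : ℝ)
          / ((1/2) * Real.log (μ n)))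
      Filter.atTop (nhds 1) := by
  obtain ⟨C, -, ν₀, hC⟩ := hgap
  have hg := tendsto_mul_of_abs_sub_le (g := fun ν => t (ν + 1) - t ν)
    (tendsto_log_atTop.comp htend) (eventually_atTop.2 ⟨ν₀, hC⟩)
  have hL : Tendsto (fun n => log (μ n)) atTop atTop := tendsto_log_atTop.comp hμ_tend
  have key : ∀ c₁ c₂ : ℝ, c₁ < 2 * π → 2 * π < c₂ → ∀ᶠ n in atTop,
      (Nat.card {ν : ℕ | Set.Icc (t ν) (t (ν + 1)) ⊆ Set.Icc (μ n) (μ (n + 1))} : ℝ)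
          * (c₁ / log (μ n)) ≤ μ (n + 1) - μ n ∧
        μ (n + 1) - μ n ≤
          ((Nat.card {ν : ℕ | Set.Icc (t ν) (t (ν + 1)) ⊆ Set.Icc (μ n) (μ (n + 1))} : ℝ) + 2)
          * (c₂ / log (μ n)) := by
    intro c₁ c₂ hc₁ hc₂
    filter_upwards [hμ_tend.eventually (eventually_gap_bounds ht_mono htend hc₁ hc₂ hg),
      hμ_tend.eventually_gt_atTop (t 0), hμ_tend.eventually_ge_atTop 4,
      hL.eventually_gt_atTop 0, hμ_gap.eventually_le_const pi_lt_four]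
      with n hn h0 h4 hlog hle
    refine card_gaps_bounds ht_mono htend h0 (hμ_mono (Nat.lt_succ_self n)).le
      (div_nonneg (by linarith [pi_pos]) hlog.le) fun ν h1 h2 => hn ν (by linarith) h2
  have hdiv : Tendsto (fun c => 2 * π / c) (nhds (2 * π)) (nhds 1) := by
    have h : ContinuousAt (fun c : ℝ => 2 * π / c) (2 * π) :=
      continuousAt_const.div continuousAt_id two_pi_pos.ne'
    simpa only [ContinuousAt, div_self two_pi_pos.ne'] using h
  refine tendsto_order.2 ⟨fun u hu => ?_, fun u hu => ?_⟩
  · obtain ⟨c, hcu, hc⟩ := (((hdiv.mono_left nhdsWithin_le_nhds).eventually_const_lt hu).and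
      (self_mem_nhdsWithin (s := Set.Ioi (2 * π)))).exists
    have hc : 2 * π < c := hc
    have hlim : Tendsto (fun n => 2 * (μ (n + 1) - μ n) / c - 4 * (log (μ n))⁻¹) atTop
        (nhds (2 * π / c)) := by
      simpa using ((hμ_gap.const_mul 2).div_const c).sub
        ((tendsto_inv_atTop_zero.comp hL).const_mul 4)
    filter_upwards [hlim.eventually_const_lt hcu, key 0 c two_pi_pos hc,
      hL.eventually_gt_atTop 0] with n h1 h2 hlog
    refine h1.trans_le ?_
    have hc0 : 0 < c := two_pi_pos.trans hc
    have h3 := h2.2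
    generalize (Nat.card _ : ℝ) = N at h3 ⊢
    have h4 : (μ (n + 1) - μ n) / c ≤ (N + 2) / log (μ n) := by
      rw [div_le_iff₀ hc0]
      exact h3.trans (le_of_eq (by ring))
    have e1 : N / (1 / 2 * log (μ n)) = 2 * ((N + 2) / log (μ n)) - 4 * (log (μ n))⁻¹ := by
      field_simp
      ring
    rw [e1, mul_div_assoc]
    linarith
  · obtain ⟨c, ⟨hcu, hc0⟩, hc⟩ := ((((hdiv.mono_left nhdsWithin_le_nhds).eventually_lt_const hu).and
      (nhdsWithin_le_nhds (lt_mem_nhds two_pi_pos))).and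
      (self_mem_nhdsWithin (s := Set.Iio (2 * π)))).exists
    have hc : c < 2 * π := hc
    have hlim : Tendsto (fun n => 2 * (μ (n + 1) - μ n) / c) atTop (nhds (2 * π / c)) :=
      (hμ_gap.const_mul 2).div_const c
    filter_upwards [hlim.eventually_lt_const hcu, key c (2 * π + 1) hc (by linarith),
      hL.eventually_gt_atTop 0] with n h1 h2 hlog
    refine lt_of_le_of_lt ?_ h1
    have h3 := h2.1
    generalize (Nat.card _ : ℝ) = N at h3 ⊢
    rw [le_div_iff₀ hc0]
    calc N / (1 / 2 * log (μ n)) * c = 2 * (N * (c / log (μ n))) := by field_simp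
      _ ≤ 2 * (μ (n + 1) - μ n) := by linarith
end
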